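/- arXiv:2106.09247 — 3 statements merged into one kernel-verified Lean document; each statement's English description precedes it below -/
import Mathlib

section
/- Let F be a field of characteristic zero and let n ≥ 10. Let K = F(c_1,…,c_n) and let p(X) = X^n + c_1 X^{n−1} + ⋯ + c_n ∈ K[X] be the general equation of degree n. Then there exist a field extension L of K obtainable by auxiliary equations of degree ≤ 4 and elements a_0, a_1, …, a_{n−1} ∈ L with (a_1,…,a_{n−1}) ≠ 0 such that, in a splitting field of p over L with roots x_1,…,x_n, the Tschirnhaus transform ∏_{i=1}^n (Y − (a_0 + a_1 x_i + ⋯ + a_{n−1} x_i^{n−1})) has vanishing coefficients in degrees Y^{n−1}, Y^{n−2}, Y^{n−3} and Y^{n−4}; i.e., it has the form Y^n + C_5 Y^{n−5} + ⋯ + C_n. -/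
open Polynomial

/-- A field extension `L/K` is *obtainable by auxiliary equations of degree at most `m`*
if there is a tower `K = L₀ ⊆ L₁ ⊆ ⋯ ⊆ L_r = L` of intermediate fields with
`[L_{i+1} : L_i] ≤ m` for each `i`. -/
def ObtainableByAuxDegLE (K L : Type*) [Field K] [Field L] [Algebra K L] (m : ℕ) : Prop :=
  ∃ (r : ℕ) (T : Fin (r + 1) → IntermediateField K L),
    T 0 = ⊥ ∧ T (Fin.last r) = ⊤ ∧
    ∀ i : Fin r, ∃ h : T i.castSucc ≤ T i.succ,
      Module.rank (T i.castSucc) (IntermediateField.extendScalars h) ≤ m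

/-- Every polynomial over `k` of degree between `1` and `m` has a root in `k`. -/
def HasRootsOfDegLE (k : Type*) [Field k] (m : ℕ) : Prop :=
  ∀ f : k[X], 0 < f.natDegree → f.natDegree ≤ m → ∃ x, f.eval x = 0

section Forms

variable {k A : Type*} [Field k]

/-- A binary form of degree `d` has a nontrivial zero if polynomials of degree `≤ d` have roots. -/
lemma HasRootsOfDegLE.exists_binaryForm_eq_zero {m : ℕ} (hk : HasRootsOfDegLE k m) {d : ℕ}
    (hd : 0 < d) (hdm : d ≤ m) (c : ℕ → k) :
    ∃ s t : k, (s ≠ 0 ∨ t ≠ 0) ∧ ∑ i ∈ Finset.range (d + 1), c i * s ^ i * t ^ (d - i) = 0 := by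
  by_cases hc : c d = 0
  · refine ⟨1, 0, Or.inl one_ne_zero, Finset.sum_eq_zero fun i hi => ?_⟩
    rcases (Finset.mem_range_succ_iff.1 hi).eq_or_lt with rfl | h
    · simp [hc]
    · simp [Nat.sub_ne_zero_of_lt h]
  · set f : k[X] := ∑ i ∈ Finset.range (d + 1), C (c i) * X ^ i with hf
    have hle : f.natDegree ≤ d :=
      natDegree_sum_le_of_forall_le _ _ fun i hi =>
        (natDegree_C_mul_X_pow_le _ _).trans (Finset.mem_range_succ_iff.1 hi)
    have hcoeff : f.coeff d = c d := by simp [hf]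
    have hdeg : f.natDegree = d :=
      hle.antisymm (le_natDegree_of_ne_zero (by rwa [hcoeff]))
    obtain ⟨x, hx⟩ := hk f (by omega) (by omega)
    refine ⟨x, 1, Or.inr one_ne_zero, ?_⟩
    simpa [hf, eval_finsetSum] using hx

variable [AddCommGroup A] [Module k A]

lemma Submodule.le_finrank_inf_ker {W : Submodule k A} {d : ℕ} (hW : d + 1 ≤ Module.finrank k W) (φ : A →ₗ[k] k) :
    d ≤ Module.finrank k (W ⊓ LinearMap.ker φ : Submodule k A) := by
  have : FiniteDimensional k W := Module.finite_of_finrank_pos (by omega)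
  have h1 := LinearMap.finrank_range_add_finrank_ker (φ.domRestrict W)
  have h2 : Module.finrank k (LinearMap.range (φ.domRestrict W)) ≤ 1 :=
    (Submodule.finrank_le _).trans (Module.finrank_self k).le
  have h3 : Module.finrank k (LinearMap.ker (φ.domRestrict W)) =
      Module.finrank k (W ⊓ LinearMap.ker φ : Submodule k A) := by
    rw [← Submodule.map_comap_subtype]
    exact (LinearEquiv.finrank_eq (Submodule.equivMapOfInjective _ W.injective_subtype _))
  omega

lemma Submodule.exists_le_finrank_notMem {W : Submodule k A} {d : ℕ}
    (hW : d + 1 ≤ Module.finrank k W) {e : A} (he : e ≠ 0) :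
    ∃ W' ≤ W, d ≤ Module.finrank k W' ∧ e ∉ W' := by
  obtain ⟨φ, hφ⟩ := Module.Projective.exists_dual_ne_zero k (x := e) he
  exact ⟨W ⊓ LinearMap.ker φ, inf_le_left, le_finrank_inf_ker hW φ, fun h => hφ h.2⟩

lemma Submodule.exists_mem_ne_zero_of_finrank {W : Submodule k A}
    (hW : 1 ≤ Module.finrank k W) : ∃ e ∈ W, e ≠ 0 := by
  have : W ≠ ⊥ := by rintro rfl; simp at hW
  exact W.exists_mem_ne_zero_of_ne_bot this

lemma Submodule.smul_add_smul_ne_zero {W : Submodule k A} {e f : A} (he : e ∉ W) (hf : f ∈ W)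
    (hf0 : f ≠ 0) {s t : k} (hst : s ≠ 0 ∨ t ≠ 0) : s • e + t • f ≠ 0 := by
  intro h
  by_cases hs : s = 0
  · simp_all
  · refine he ?_
    have : s • e ∈ W := by
      rw [eq_neg_of_add_eq_zero_left h]
      exact W.neg_mem (W.smul_mem t hf)
    exact (W.smul_mem_iff hs).1 this

namespace HasRootsOfDegLE

lemma exists_quadratic {m : ℕ} (hk : HasRootsOfDegLE k m) (hm : 2 ≤ m) (a b c : k) :
    ∃ s t : k, (s ≠ 0 ∨ t ≠ 0) ∧ a * s ^ 2 + b * s * t + c * t ^ 2 = 0 := by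
  obtain ⟨s, t, hst, h⟩ := hk.exists_binaryForm_eq_zero (d := 2) (by omega) hm
    (fun | 0 => c | 1 => b | _ => a)
  refine ⟨s, t, hst, ?_⟩
  simp only [Finset.sum_range_succ, Finset.sum_range_zero] at h
  linear_combination h

lemma exists_cubic {m : ℕ} (hk : HasRootsOfDegLE k m) (hm : 3 ≤ m) (a b c d : k) :
    ∃ s t : k, (s ≠ 0 ∨ t ≠ 0) ∧
      a * s ^ 3 + b * s ^ 2 * t + c * s * t ^ 2 + d * t ^ 3 = 0 := by
  obtain ⟨s, t, hst, h⟩ := hk.exists_binaryForm_eq_zero (d := 3) (by omega) hm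
    (fun | 0 => d | 1 => c | 2 => b | _ => a)
  refine ⟨s, t, hst, ?_⟩
  simp only [Finset.sum_range_succ, Finset.sum_range_zero] at h
  linear_combination h

lemma exists_quartic {m : ℕ} (hk : HasRootsOfDegLE k m) (hm : 4 ≤ m) (a b c d e : k) :
    ∃ s t : k, (s ≠ 0 ∨ t ≠ 0) ∧
      a * s ^ 4 + b * s ^ 3 * t + c * s ^ 2 * t ^ 2 + d * s * t ^ 3 + e * t ^ 4 = 0 := by
  obtain ⟨s, t, hst, h⟩ := hk.exists_binaryForm_eq_zero (d := 4) (by omega) hm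
    (fun | 0 => e | 1 => d | 2 => c | 3 => b | _ => a)
  refine ⟨s, t, hst, ?_⟩
  simp only [Finset.sum_range_succ, Finset.sum_range_zero] at h
  linear_combination h

/-- A quadratic form has a nontrivial zero on every plane. -/
lemma exists_isotropic {m : ℕ} (hk : HasRootsOfDegLE k m) (hm : 2 ≤ m)
    (b : A →ₗ[k] A →ₗ[k] k) {W : Submodule k A} (hW : 2 ≤ Module.finrank k W) :
    ∃ w ∈ W, w ≠ 0 ∧ b w w = 0 := by
  obtain ⟨e, heW, he⟩ := Submodule.exists_mem_ne_zero_of_finrank (W := W) (by omega)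
  obtain ⟨W', hW', hd, heW'⟩ := Submodule.exists_le_finrank_notMem hW he
  obtain ⟨f, hfW, hf⟩ := Submodule.exists_mem_ne_zero_of_finrank hd
  obtain ⟨s, t, hst, h⟩ := hk.exists_quadratic hm (b e e) (b e f + b f e) (b f f)
  refine ⟨s • e + t • f, W.add_mem (W.smul_mem _ heW) (W.smul_mem _ (hW' hfW)),
    Submodule.smul_add_smul_ne_zero heW' hfW hf hst, ?_⟩
  simp only [map_add, map_smul, LinearMap.add_apply, LinearMap.smul_apply, smul_eq_mul]
  linear_combination h

/-- Every pencil of `3 × 3` matrices contains a singular member. -/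
lemma exists_det_eq_zero {m : ℕ} (hk : HasRootsOfDegLE k m) (hm : 3 ≤ m)
    (M N : Matrix (Fin 3) (Fin 3) k) :
    ∃ s t : k, (s ≠ 0 ∨ t ≠ 0) ∧ (s • M + t • N).det = 0 := by
  by_cases hM : M.det = 0
  · exact ⟨1, 0, Or.inl one_ne_zero, by simpa using hM⟩
  · set f : k[X] := ((X : k[X]) • M.map C + N.map C).det with hf
    have hle : f.natDegree ≤ 3 := natDegree_det_X_add_C_le M N
    have hco : f.coeff 3 = M.det := coeff_det_X_add_C_card M N
    have hge : 3 ≤ f.natDegree := le_natDegree_of_ne_zero (by rwa [hco])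
    obtain ⟨x, hx⟩ := hk f (by omega) (by omega)
    refine ⟨x, 1, Or.inr one_ne_zero, ?_⟩
    rw [← hx, hf, ← coe_evalRingHom, RingHom.map_det]
    congr 1
    ext i j
    simpa using mul_comm _ _

/-- Two quadratic forms have a common nontrivial zero on every three-dimensional space. -/
lemma exists_isotropic_pair {m : ℕ} (hk : HasRootsOfDegLE k m) (hm : 3 ≤ m)
    (b₁ b₂ : A →ₗ[k] A →ₗ[k] k) (h₁ : ∀ x y, b₁ x y = b₁ y x) (h₂ : ∀ x y, b₂ x y = b₂ y x)
    {W : Submodule k A} (hW : 3 ≤ Module.finrank k W) :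
    ∃ w ∈ W, w ≠ 0 ∧ b₁ w w = 0 ∧ b₂ w w = 0 := by
  obtain ⟨e, he⟩ := exists_linearIndependent_of_le_finrank hW
  replace he := he.map' W.subtype (Submodule.ker_subtype W)
  set v : Fin 3 → A := W.subtype ∘ e with hv
  have hvW : Submodule.span k (Set.range v) ≤ W := by
    rw [Submodule.span_le]
    rintro _ ⟨i, rfl⟩
    exact (e i).2
  obtain ⟨s, t, hst, hdet⟩ := hk.exists_det_eq_zero hm
    (Matrix.of fun i j => b₁ (v i) (v j)) (Matrix.of fun i j => b₂ (v i) (v j))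
  obtain ⟨z, hz, hmul⟩ := Matrix.exists_mulVec_eq_zero_iff.2 hdet
  set u : A := ∑ i, z i • v i with hu
  have huV : u ∈ Submodule.span k (Set.range v) :=
    Submodule.sum_mem _ fun i _ => Submodule.smul_mem _ _ (Submodule.subset_span ⟨i, rfl⟩)
  have hu0 : u ≠ 0 := fun h => hz (funext fun i => Fintype.linearIndependent_iff.1 he z h i)
  set b : A →ₗ[k] A →ₗ[k] k := s • b₁ + t • b₂ with hb
  have hrad : ∀ x ∈ Submodule.span k (Set.range v), b x u = 0 := by
    intro x hx
    induction hx using Submodule.span_induction with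
    | mem x hx =>
      obtain ⟨i, rfl⟩ := hx
      have := congrFun hmul i
      simp only [Matrix.mulVec, dotProduct, Matrix.add_apply, Matrix.smul_apply, Matrix.of_apply,
        Pi.zero_apply] at this
      rw [← this, hu, map_sum]
      refine Finset.sum_congr rfl fun j _ => ?_
      simp [hb]
      ring
    | zero => simp
    | add x y _ _ hx hy => simp [hx, hy]
    | smul a x _ hx => simp [hx]
  have hdim : 2 + 1 ≤ Module.finrank k (Submodule.span k (Set.range v)) := by
    rw [finrank_span_eq_card he]; simp
  obtain ⟨V, hV, hVd, huV'⟩ := Submodule.exists_le_finrank_notMem hdim hu0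
  obtain ⟨w, hwV, hw0, hw⟩ := hk.exists_isotropic (by omega) b hVd
  have hplane : ∀ x y : k, b (x • u + y • w) (x • u + y • w) = 0 := by
    intro x y
    have hsymm : b u w = b w u := by simp [hb, h₁ u w, h₂ u w]
    simp [hsymm, hrad u huV, hrad w (hV hwV), hw]
  have hmem : ∀ x y : k, x • u + y • w ∈ W := fun x y =>
    W.add_mem (W.smul_mem _ (hvW huV)) (W.smul_mem _ (hvW (hV hwV)))
  rcases hst with hs | ht
  · obtain ⟨x, y, hxy, h⟩ := hk.exists_quadratic (by omega) (b₂ u u) (b₂ u w + b₂ w u) (b₂ w w)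
    have h' : b₂ (x • u + y • w) (x • u + y • w) = 0 := by
      simp only [map_add, map_smul, LinearMap.add_apply, LinearMap.smul_apply, smul_eq_mul]
      linear_combination h
    have := hplane x y
    rw [hb, LinearMap.add_apply, LinearMap.add_apply, LinearMap.smul_apply, LinearMap.smul_apply,
      LinearMap.smul_apply, LinearMap.smul_apply, h', smul_zero, add_zero, smul_eq_mul] at this
    exact ⟨_, hmem x y, Submodule.smul_add_smul_ne_zero huV' hwV hw0 hxy,
      (mul_eq_zero.1 this).resolve_left hs, h'⟩
  · obtain ⟨x, y, hxy, h⟩ := hk.exists_quadratic (by omega) (b₁ u u) (b₁ u w + b₁ w u) (b₁ w w)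
    have h' : b₁ (x • u + y • w) (x • u + y • w) = 0 := by
      simp only [map_add, map_smul, LinearMap.add_apply, LinearMap.smul_apply, smul_eq_mul]
      linear_combination h
    have := hplane x y
    rw [hb, LinearMap.add_apply, LinearMap.add_apply, LinearMap.smul_apply, LinearMap.smul_apply,
      LinearMap.smul_apply, LinearMap.smul_apply, h', smul_zero, zero_add, smul_eq_mul] at this
    exact ⟨_, hmem x y, Submodule.smul_add_smul_ne_zero huV' hwV hw0 hxy, h',
      (mul_eq_zero.1 this).resolve_left ht⟩

end HasRootsOfDegLE

end Forms

section PowerTraces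

variable {k A : Type*} [Field k] [CommRing A] [Algebra k A]

/-- The symmetric bilinear form `(x, y) ↦ τ (r x y)`. -/
def twistedTraceForm (τ : A →ₗ[k] k) (r : A) : A →ₗ[k] A →ₗ[k] k :=
  (LinearMap.mul k A).compr₂ (τ ∘ₗ LinearMap.mulLeft k r)

@[simp]
lemma twistedTraceForm_apply (τ : A →ₗ[k] k) (r x y : A) :
    twistedTraceForm τ r x y = τ (r * (x * y)) := rfl

lemma twistedTraceForm_comm (τ : A →ₗ[k] k) (r x y : A) :
    twistedTraceForm τ r x y = twistedTraceForm τ r y x := by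
  simp [mul_comm x y]

lemma map_smul_add_smul_sq (τ : A →ₗ[k] k) (s t : k) (e f : A) :
    τ ((s • e + t • f) ^ 2) =
      τ (e ^ 2) * s ^ 2 + 2 * τ (e * f) * s * t + τ (f ^ 2) * t ^ 2 := by
  have : (s • e + t • f) ^ 2 =
      (s ^ 2) • e ^ 2 + (2 * s * t) • (e * f) + (t ^ 2) • f ^ 2 := by
    simp only [Algebra.smul_def, map_mul, map_pow, map_ofNat]
    ring
  rw [this]
  simp only [map_add, map_smul, smul_eq_mul]
  ring

lemma map_smul_add_smul_pow_three (τ : A →ₗ[k] k) (s t : k) (e f : A) :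
    τ ((s • e + t • f) ^ 3) = τ (e ^ 3) * s ^ 3 + 3 * τ (e ^ 2 * f) * s ^ 2 * t +
      3 * τ (e * f ^ 2) * s * t ^ 2 + τ (f ^ 3) * t ^ 3 := by
  have : (s • e + t • f) ^ 3 = (s ^ 3) • e ^ 3 + (3 * s ^ 2 * t) • (e ^ 2 * f) +
      (3 * s * t ^ 2) • (e * f ^ 2) + (t ^ 3) • f ^ 3 := by
    simp only [Algebra.smul_def, map_mul, map_pow, map_ofNat]
    ring
  rw [this]
  simp only [map_add, map_smul, smul_eq_mul]
  ring

lemma map_smul_add_smul_pow_four (τ : A →ₗ[k] k) (s t : k) (e f : A) :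
    τ ((s • e + t • f) ^ 4) = τ (e ^ 4) * s ^ 4 + 4 * τ (e ^ 3 * f) * s ^ 3 * t +
      6 * τ (e ^ 2 * f ^ 2) * s ^ 2 * t ^ 2 + 4 * τ (e * f ^ 3) * s * t ^ 3 +
      τ (f ^ 4) * t ^ 4 := by
  have : (s • e + t • f) ^ 4 = (s ^ 4) • e ^ 4 + (4 * s ^ 3 * t) • (e ^ 3 * f) +
      (6 * s ^ 2 * t ^ 2) • (e ^ 2 * f ^ 2) + (4 * s * t ^ 3) • (e * f ^ 3) +
      (t ^ 4) • f ^ 4 := by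
    simp only [Algebra.smul_def, map_mul, map_pow, map_ofNat]
    ring
  rw [this]
  simp only [map_add, map_smul, smul_eq_mul]
  ring

namespace HasRootsOfDegLE

variable {m : ℕ}

/-- Two quadratic forms have a common totally isotropic plane in every six-dimensional space, on
which any cubic form then has a nontrivial zero. -/
lemma exists_common_zero_cubic (hk : HasRootsOfDegLE k m) (hm : 3 ≤ m) (τ : A →ₗ[k] k) (r : A)
    {W : Submodule k A} (hW : 6 ≤ Module.finrank k W) :
    ∃ x ∈ W, x ≠ 0 ∧ τ (x ^ 2) = 0 ∧ τ (r * x ^ 2) = 0 ∧ τ (x ^ 3) = 0 := by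
  obtain ⟨e, heW, he0, he1, her⟩ := hk.exists_isotropic_pair hm (twistedTraceForm τ 1)
    (twistedTraceForm τ r) (twistedTraceForm_comm τ 1) (twistedTraceForm_comm τ r)
    (W := W) (by omega)
  obtain ⟨V, hV, hVd, heV⟩ := Submodule.exists_le_finrank_notMem
    (Submodule.le_finrank_inf_ker (Submodule.le_finrank_inf_ker hW (twistedTraceForm τ 1 e))
      (twistedTraceForm τ r e)) he0
  obtain ⟨f, hfV, hf0, hf1, hfr⟩ := hk.exists_isotropic_pair hm (twistedTraceForm τ 1)
    (twistedTraceForm τ r) (twistedTraceForm_comm τ 1) (twistedTraceForm_comm τ r) hVd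
  obtain ⟨s, t, hst, h⟩ := hk.exists_cubic hm (τ (e ^ 3)) (3 * τ (e ^ 2 * f))
    (3 * τ (e * f ^ 2)) (τ (f ^ 3))
  obtain ⟨⟨hfW, hef1⟩, hefr⟩ := hV hfV
  have hef1 : τ (1 * (e * f)) = 0 := hef1
  have hefr : τ (r * (e * f)) = 0 := hefr
  simp only [twistedTraceForm_apply, ← sq, one_mul] at he1 her hf1 hfr hef1
  refine ⟨s • e + t • f, W.add_mem (W.smul_mem _ heW) (W.smul_mem _ hfW),
    Submodule.smul_add_smul_ne_zero heV hfV hf0 hst, ?_, ?_, ?_⟩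
  · rw [map_smul_add_smul_sq, he1, hef1, hf1]
    ring
  · have := map_smul_add_smul_sq (τ ∘ₗ LinearMap.mulLeft k r) s t e f
    simp only [LinearMap.comp_apply, LinearMap.mulLeft_apply] at this
    rw [this, her, hefr, hfr]
    ring
  · rw [map_smul_add_smul_pow_three, h]

/-- On every ten-dimensional subspace of a commutative algebra, the first four power traces have
a nontrivial common zero. -/
theorem exists_powerTraces_eq_zero (hk : HasRootsOfDegLE k m) (hm : 4 ≤ m) (τ : A →ₗ[k] k)
    {W : Submodule k A} (hW : 10 ≤ Module.finrank k W) :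
    ∃ x ∈ W, x ≠ 0 ∧ τ x = 0 ∧ τ (x ^ 2) = 0 ∧ τ (x ^ 3) = 0 ∧ τ (x ^ 4) = 0 := by
  obtain ⟨V, hV, hVd⟩ : ∃ V ≤ W ⊓ LinearMap.ker τ, 9 ≤ Module.finrank k V :=
    ⟨_, le_rfl, Submodule.le_finrank_inf_ker hW τ⟩
  obtain ⟨P, hPV, hP0, hP2, -, hP3⟩ :=
    hk.exists_common_zero_cubic (by omega) τ 1 (W := V) (by omega)
  obtain ⟨U, hU, hUd, hPU⟩ := Submodule.exists_le_finrank_notMem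
    (Submodule.le_finrank_inf_ker (Submodule.le_finrank_inf_ker hVd
      (τ ∘ₗ LinearMap.mulLeft k P)) (τ ∘ₗ LinearMap.mulLeft k (P ^ 2))) hP0
  obtain ⟨v, hvU, hv0, hv2, hPv2, hv3⟩ :=
    hk.exists_common_zero_cubic (by omega) τ P (W := U) (by omega)
  obtain ⟨⟨hvV, hPv⟩, hP2v⟩ := hU hvU
  have hPv : τ (P * v) = 0 := hPv
  have hP2v : τ (P ^ 2 * v) = 0 := hP2v
  obtain ⟨s, t, hst, h⟩ := hk.exists_quartic hm (τ (P ^ 4)) (4 * τ (P ^ 3 * v))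
    (6 * τ (P ^ 2 * v ^ 2)) (4 * τ (P * v ^ 3)) (τ (v ^ 4))
  have hx : s • P + t • v ∈ W ⊓ LinearMap.ker τ :=
    hV (V.add_mem (V.smul_mem _ hPV) (V.smul_mem _ hvV))
  refine ⟨_, hx.1, Submodule.smul_add_smul_ne_zero hPU hvU hv0 hst, hx.2, ?_, ?_, ?_⟩
  · rw [map_smul_add_smul_sq, hP2, hPv, hv2]
    ring
  · rw [map_smul_add_smul_pow_three, hP3, hP2v, hPv2, hv3]
    ring
  · rw [map_smul_add_smul_pow_four, h]

end HasRootsOfDegLE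

end PowerTraces

section AuxiliaryTowers

open IntermediateField

variable {K Ω : Type*} [Field K] [Field Ω] [Algebra K Ω]

/-- `E'` is obtained from `E` by adjoining a root of a nonzero polynomial of degree at most `m`. -/
def AuxStep (m : ℕ) (E E' : IntermediateField K Ω) : Prop :=
  ∃ (f : E[X]) (x : Ω), f ≠ 0 ∧ f.natDegree ≤ m ∧ aeval x f = 0 ∧ E' = E ⊔ K⟮x⟯

lemma AuxStep.exists_rank_le {m : ℕ} {E E' : IntermediateField K Ω} (h : AuxStep m E E') :
    ∃ hle : E ≤ E', Module.rank E (extendScalars hle) ≤ m := by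
  obtain ⟨f, x, hf0, hfm, hx, rfl⟩ := h
  refine ⟨le_sup_left, ?_⟩
  have hext : extendScalars (le_sup_left : E ≤ E ⊔ K⟮x⟯) = E⟮x⟯ := by
    apply restrictScalars_injective K
    rw [restrictScalars_adjoin_eq_sup, extendScalars_restrictScalars]
  have hint : IsIntegral E x := (IsAlgebraic.isIntegral ⟨f, hf0, hx⟩)
  have : FiniteDimensional E E⟮x⟯ := adjoin.finiteDimensional hint
  rw [hext, ← Module.finrank_eq_rank, adjoin.finrank hint]
  exact_mod_cast (natDegree_le_of_dvd (minpoly.dvd E x hx) hf0).trans hfm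

lemma AuxStep.sup_left {m : ℕ} {E E' : IntermediateField K Ω} (h : AuxStep m E E')
    (G : IntermediateField K Ω) : AuxStep m (G ⊔ E) (G ⊔ E') := by
  obtain ⟨f, x, hf0, hfm, hx, rfl⟩ := h
  refine ⟨f.map (inclusion (le_sup_right : E ≤ G ⊔ E)).toRingHom, x, ?_, ?_, ?_, ?_⟩
  · rwa [Ne, Polynomial.map_eq_zero]
  · rwa [natDegree_map]
  · rw [aeval_def, eval₂_map, ← hx, aeval_def]
    rfl
  · rw [sup_assoc]

/-- `E` is the top of a finite tower of subextensions of `Ω/K` of steps of degree at most `m`. -/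
def IsAuxTower (m : ℕ) (E : IntermediateField K Ω) : Prop :=
  Relation.ReflTransGen (AuxStep m) ⊥ E

lemma IsAuxTower.sup {m : ℕ} {E G : IntermediateField K Ω} (hE : IsAuxTower m E)
    (hG : IsAuxTower m G) : IsAuxTower m (G ⊔ E) := by
  refine hG.trans ?_
  have := Relation.ReflTransGen.lift (G ⊔ ·) (fun _ _ h => AuxStep.sup_left h G) _ _ hE
  simpa [Function.onFun] using this

lemma IsAuxTower.exists_sequence {m : ℕ} {E : IntermediateField K Ω} (hE : IsAuxTower m E) :
    ∃ (r : ℕ) (T : ℕ → IntermediateField K Ω), T 0 = ⊥ ∧ T r = E ∧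
      ∀ i < r, AuxStep m (T i) (T (i + 1)) := by
  induction hE with
  | refl => exact ⟨0, fun _ => ⊥, rfl, rfl, by simp⟩
  | @tail E E' _ hstep ih =>
    obtain ⟨r, T, h0, hr, hT⟩ := ih
    refine ⟨r + 1, fun i => if i ≤ r then T i else E', by simpa using h0, by simp, fun i hi => ?_⟩
    rcases (Nat.lt_succ_iff.1 hi).eq_or_lt with rfl | hlt
    · simpa [hr] using hstep
    · simpa [hlt.le, Nat.succ_le_of_lt hlt] using hT i hlt

lemma rank_extendScalars_restrict {E E' L : IntermediateField K Ω} (h : E ≤ E') (h' : E' ≤ L)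
    (hr : restrict (h.trans h') ≤ restrict h') :
    Module.rank (restrict (h.trans h')) (extendScalars hr) = Module.rank E (extendScalars h) :=
  (Algebra.rank_eq_of_equiv_equiv (restrictAlgEquiv (h.trans h')).toRingEquiv
    (show extendScalars h ≃+* extendScalars hr from (restrictAlgEquiv h').toRingEquiv) rfl).symm

theorem IsAuxTower.obtainable {m : ℕ} {L : IntermediateField K Ω} (hL : IsAuxTower m L) :
    ObtainableByAuxDegLE K L m := by
  obtain ⟨r, T, h0, hr, hT⟩ := hL.exists_sequence
  have hle : ∀ i ≤ r, T i ≤ L := by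
    intro i hi
    induction hi using Nat.decreasingInduction with
    | self => exact hr.le
    | of_succ j hj ih => exact (hT j hj).exists_rank_le.1.trans ih
  refine ⟨r, fun i => restrict (hle i (Nat.lt_succ_iff.1 i.2)), ?_, ?_, fun i => ?_⟩
  · apply lift_injective
    simp [lift_restrict, h0]
  · apply lift_injective
    simp [lift_restrict, hr]
  · obtain ⟨h, hrank⟩ := (hT i i.2).exists_rank_le
    have hmono : restrict (hle i i.2.le) ≤ restrict (hle (i + 1) i.2) := fun x hx =>
      (mem_restrict _ x).2 (h ((mem_restrict _ x).1 hx))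
    exact ⟨hmono, (rank_extendScalars_restrict h (hle (i + 1) i.2) hmono).trans_le hrank⟩

variable (K Ω) in
/-- The union of all finite towers of steps of degree at most `m` inside `Ω/K`. -/
def auxClosure (m : ℕ) : IntermediateField K Ω :=
  ⨆ E : {E : IntermediateField K Ω // IsAuxTower m E}, E.1

instance (m : ℕ) : Nonempty {E : IntermediateField K Ω // IsAuxTower m E} :=
  ⟨⟨⊥, Relation.ReflTransGen.refl⟩⟩

lemma directed_isAuxTower (m : ℕ) : Directed (· ≤ ·)
    (fun E : {E : IntermediateField K Ω // IsAuxTower m E} => E.1) := fun E G =>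
  ⟨⟨_, E.2.sup G.2⟩, le_sup_right, le_sup_left⟩

lemma mem_auxClosure {m : ℕ} {x : Ω} :
    x ∈ auxClosure K Ω m ↔ ∃ E : {E : IntermediateField K Ω // IsAuxTower m E}, x ∈ E.1 := by
  rw [← SetLike.mem_coe, auxClosure, coe_iSup_of_directed (directed_isAuxTower m)]
  simp

lemma exists_isAuxTower_forall_mem {m : ℕ} {ι : Type*} [Finite ι] (a : ι → auxClosure K Ω m) :
    ∃ E : IntermediateField K Ω, IsAuxTower m E ∧ ∀ i, (a i : Ω) ∈ E := by
  choose E hE using fun i => mem_auxClosure.1 (a i).2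
  obtain ⟨G, hG⟩ := (directed_isAuxTower (K := K) (Ω := Ω) m).finite_le E
  exact ⟨G.1, G.2, fun i => hG i (hE i)⟩

theorem hasRootsOfDegLE_auxClosure [IsAlgClosed Ω] (m : ℕ) :
    HasRootsOfDegLE (auxClosure K Ω m) m := by
  intro f hf0 hfm
  obtain ⟨x, hx⟩ := IsAlgClosed.exists_aeval_eq_zero Ω f (natDegree_pos_iff_degree_pos.1 hf0).ne'
  obtain ⟨E, hE, hmem⟩ := exists_isAuxTower_forall_mem
    (fun i : Fin (f.natDegree + 1) => f.coeff i)
  obtain ⟨g, hg⟩ : f.map (algebraMap (auxClosure K Ω m) Ω) ∈ lifts (algebraMap E Ω) := by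
    rw [lifts_iff_coeff_lifts]
    intro i
    rw [coeff_map]
    by_cases hi : i < f.natDegree + 1
    · exact ⟨⟨_, hmem ⟨i, hi⟩⟩, rfl⟩
    · rw [coeff_eq_zero_of_natDegree_lt (by omega)]
      exact ⟨0, by simp⟩
  rw [coe_mapRingHom] at hg
  have hdeg : g.natDegree = f.natDegree := by
    rw [← natDegree_map (algebraMap E Ω), hg, natDegree_map]
  have hstep : AuxStep m E (E ⊔ K⟮x⟯) := by
    refine ⟨g, x, ?_, hdeg.trans_le hfm, ?_, rfl⟩
    · rintro rfl
      simp at hdeg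
      omega
    · rw [aeval_def, ← eval_map, hg, eval_map, ← aeval_def, hx]
  have hxmem : x ∈ auxClosure K Ω m :=
    mem_auxClosure.2 ⟨⟨_, hE.tail hstep⟩, (le_sup_right : K⟮x⟯ ≤ _) (mem_adjoin_simple_self K x)⟩
  refine ⟨⟨x, hxmem⟩, Subtype.ext ?_⟩
  have := hx
  rw [show x = algebraMap (auxClosure K Ω m) Ω ⟨x, hxmem⟩ from rfl, aeval_algebraMap_apply] at this
  simpa using this

end AuxiliaryTowers

section PowerSums

lemma Multiset.esymm_eq_zero_of_sum_pow_eq_zero {M : Type*} [Field M] [CharZero M]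
    (s : Multiset M) {j : ℕ} (hj : j ≠ 0)
    (h : ∀ i, 1 ≤ i → i ≤ j → (s.map (· ^ i)).sum = 0) : s.esymm j = 0 := by
  classical
  have hN := congrArg (MvPolynomial.aeval (fun x : s => (x : M)))
    (MvPolynomial.mul_esymm_eq_sum s M j)
  rw [map_mul, MvPolynomial.aeval_esymm_eq_multiset_esymm, Multiset.map_univ_coe, map_mul,
    map_sum, Finset.sum_eq_zero, mul_zero, map_natCast] at hN
  · exact (mul_eq_zero.1 hN).resolve_left (Nat.cast_ne_zero.2 hj)
  · intro a ha
    obtain ⟨hmem, hlt⟩ := Finset.mem_filter.1 ha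
    have hsum := Finset.HasAntidiagonal.mem_antidiagonal.1 hmem
    have hps : MvPolynomial.aeval (fun x : s => (x : M)) (MvPolynomial.psum s M a.2) =
        (s.map (· ^ a.2)).sum := by
      conv_rhs => rw [← Multiset.map_univ_coe s]
      rw [Multiset.map_map]
      simp only [MvPolynomial.psum, map_sum, map_pow, MvPolynomial.aeval_X]
      rfl
    rw [map_mul, hps, h _ (by omega) (by omega), mul_zero]

lemma Multiset.coeff_prod_X_sub_C_eq_zero {M : Type*} [Field M] [CharZero M]
    (s : Multiset M) {j : ℕ} (hj : j ≠ 0) (hjs : j ≤ s.card)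
    (h : ∀ i, 1 ≤ i → i ≤ j → (s.map (· ^ i)).sum = 0) :
    (s.map fun t => X - C t).prod.coeff (s.card - j) = 0 := by
  rw [Multiset.prod_X_sub_C_coeff _ (Nat.sub_le _ _), Nat.sub_sub_self hjs,
    s.esymm_eq_zero_of_sum_pow_eq_zero hj h, mul_zero]

/-- The power sums of the roots of a polynomial lie in the field of coefficients. -/
lemma Polynomial.exists_sum_roots_pow.{u, v} {K : Type u} [Field K] [CharZero K] (p : K[X]) :
    ∃ s : ℕ → K, ∀ {N : Type v} [Field N] (φ : K →+* N), (p.map φ).Splits →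
      ∀ j, ((p.map φ).roots.map (· ^ j)).sum = φ (s j) := by
  have hsplit := SplittingField.splits p
  have : IsGalois K p.SplittingField := ⟨⟩
  have key : ∀ j, ∃ s : K, algebraMap K p.SplittingField s =
      ((p.aroots p.SplittingField).map (· ^ j)).sum := by
    intro j
    have := (IsGalois.mem_bot_iff_fixed (F := K)
      ((p.aroots p.SplittingField).map (· ^ j)).sum).2 fun σ => ?_
    · exact IntermediateField.mem_bot.1 this
    · have hroots := hsplit.roots_map (σ : p.SplittingField →+* p.SplittingField)
      rw [Polynomial.map_map, show ((σ : p.SplittingField →+* p.SplittingField).comp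
        (algebraMap K p.SplittingField)) = algebraMap K p.SplittingField from
          RingHom.ext fun x => σ.commutes x] at hroots
      conv_rhs => rw [aroots_def, hroots]
      simp [map_multiset_sum, Multiset.map_map, aroots_def]
  choose s hs using key
  refine ⟨s, fun {N} _ φ hφ j => ?_⟩
  let := φ.toAlgebra
  let ψ : p.SplittingField →ₐ[K] N := IsSplittingField.lift _ p hφ
  have hroots := hsplit.roots_map (ψ : p.SplittingField →+* N)
  rw [Polynomial.map_map, show (ψ : p.SplittingField →+* N).comp
    (algebraMap K p.SplittingField) = φ from RingHom.ext fun x => ψ.commutes x] at hroots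
  rw [hroots, show φ (s j) = ψ (algebraMap K _ (s j)) from (ψ.commutes (s j)).symm, hs]
  simp [map_multiset_sum, Multiset.map_map, aroots_def]

/-- The linear functional on `R[X]` with values `s j` on the monomials `X ^ j`. -/
noncomputable def momentFunctional {R : Type*} [CommRing R] (s : ℕ → R) : R[X] →ₗ[R] R :=
  Polynomial.lsum fun j => LinearMap.mulRight R (s j)

lemma momentFunctional_monomial {R : Type*} [CommRing R] (s : ℕ → R) (j : ℕ) (a : R) :
    momentFunctional s (monomial j a) = a * s j := by
  simp [momentFunctional, sum_monomial_index]

lemma momentFunctional_map {R S : Type*} [CommRing R] [CommRing S] (φ : R →+* S) (s : ℕ → R)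
    (g : R[X]) : momentFunctional (φ ∘ s) (g.map φ) = φ (momentFunctional s g) := by
  induction g using Polynomial.induction_on' with
  | add f g hf hg => simp [hf, hg]
  | monomial j a => simp [momentFunctional_monomial]

lemma momentFunctional_eq_sum_eval {N : Type*} [CommRing N] (s : ℕ → N) (Y : Multiset N)
    (hY : ∀ j, (Y.map (· ^ j)).sum = s j) (g : N[X]) :
    momentFunctional s g = (Y.map fun y => g.eval y).sum := by
  induction g using Polynomial.induction_on' with
  | add f g hf hg => simp [hf, hg, Multiset.sum_map_add]
  | monomial j a => simp [momentFunctional_monomial, ← hY, Multiset.sum_map_mul_left]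

end PowerSums

section Tschirnhaus

/-- Every monic polynomial of degree `n ≥ 10` admits a nonconstant Tschirnhaus transformation, with
parameters in a tower of steps of degree at most `4`, annihilating the first four power sums. -/
theorem exists_tschirnhaus_sum_pow_eq_zero {K : Type} [Field K] [CharZero K] {n : ℕ} (hn : 10 ≤ n)
    (p : K[X]) (hdeg : p.natDegree = n) :
    ∃ (L : Type) (_ : Field L) (_ : Algebra K L), ObtainableByAuxDegLE K L 4 ∧
      ∃ a : Fin n → L, (∃ i : Fin n, (i : ℕ) ≠ 0 ∧ a i ≠ 0) ∧
        ∀ (M : Type) [Field M] (φ : L →+* M), ((p.map (algebraMap K L)).map φ).Splits →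
          ∀ i, 1 ≤ i → i ≤ 4 → (((p.map (algebraMap K L)).map φ).roots.map
            fun x => (∑ k : Fin n, φ (a k) * x ^ (k : ℕ)) ^ i).sum = 0 := by
  obtain ⟨s, hs⟩ := Polynomial.exists_sum_roots_pow.{0, 0} p
  let Ω := AlgebraicClosure K
  have hs0 : s 0 ≠ 0 := by
    have h := hs (algebraMap K Ω) (IsAlgClosed.splits _) 0
    intro h0
    have hcard := (IsAlgClosed.splits (p.map (algebraMap K Ω))).natDegree_eq_card_roots
    rw [natDegree_map, hdeg] at hcard
    simp [h0, ← hcard] at h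
    omega
  let k := auxClosure K Ω 4
  obtain ⟨g, hgW, hg0, hg1, hg2, hg3, hg4⟩ :=
    (hasRootsOfDegLE_auxClosure (K := K) (Ω := Ω) 4).exists_powerTraces_eq_zero le_rfl
      (momentFunctional (algebraMap K k ∘ s)) (W := degreeLT k n)
      (by rw [(degreeLTEquiv k n).finrank_eq]; simpa using hn)
  have hgn : g.natDegree < n := by
    rw [mem_degreeLT] at hgW
    exact (natDegree_lt_iff_degree_lt hg0).2 hgW
  obtain ⟨E, hE, hmem⟩ := exists_isAuxTower_forall_mem (fun i : Fin n => g.coeff i)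
  let a : Fin n → E := fun i => ⟨(g.coeff i : Ω), hmem i⟩
  let gE : E[X] := ∑ i : Fin n, C (a i) * X ^ (i : ℕ)
  have hmap : gE.map (algebraMap E Ω) = g.map (algebraMap k Ω) := by
    rw [g.as_sum_range' n hgn, ← Fin.sum_univ_eq_sum_range (fun i => monomial i (g.coeff i))]
    simp only [gE, Polynomial.map_sum, Polynomial.map_mul, Polynomial.map_pow, map_C, map_X,
      ← C_mul_X_pow_eq_monomial]
    rfl
  have hzero : ∀ i, 1 ≤ i → i ≤ 4 → momentFunctional (algebraMap K E ∘ s) (gE ^ i) = 0 := by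
    intro i h1 h4
    have hk : momentFunctional (algebraMap K k ∘ s) (g ^ i) = 0 := by
      interval_cases i
      · simpa using hg1
      · exact hg2
      · exact hg3
      · exact hg4
    apply (algebraMap E Ω).injective
    rw [map_zero, ← map_zero (algebraMap k Ω), ← hk, ← momentFunctional_map,
      ← momentFunctional_map, Polynomial.map_pow, Polynomial.map_pow, hmap]
    rfl
  refine ⟨E, inferInstance, inferInstance, hE.obtainable, a, ?_, ?_⟩
  · by_contra! hall
    have hgC : g = C (g.coeff 0) := by
      refine eq_C_of_natDegree_eq_zero (natDegree_eq_zero_iff_degree_le_zero.2 ?_)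
      rw [degree_le_zero_iff]
      refine Polynomial.ext fun i => ?_
      rcases Nat.eq_zero_or_pos i with rfl | hi
      · simp
      · rw [coeff_C_of_ne_zero hi.ne']
        by_cases hin : i < n
        · have h : (g.coeff i : Ω) = 0 := congrArg (algebraMap E Ω) (hall ⟨i, hin⟩ hi.ne')
          exact ZeroMemClass.coe_eq_zero.1 h
        · rw [coeff_eq_zero_of_natDegree_lt (by omega)]
    rw [hgC, ← monomial_zero_left, momentFunctional_monomial, mul_eq_zero] at hg1
    rcases hg1 with h | h
    · exact hg0 (by rw [hgC, h, C_0])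
    · exact hs0 ((map_eq_zero _).1 h)
  · intro M _ φ hsplit i h1 h4
    rw [Polynomial.map_map] at hsplit ⊢
    have key := momentFunctional_eq_sum_eval _ _ (hs _ hsplit) ((gE ^ i).map φ)
    have hmom := momentFunctional_map φ (algebraMap K E ∘ s) (gE ^ i)
    rw [hzero i h1 h4, map_zero] at hmom
    refine Eq.trans ?_ (key.symm.trans hmom)
    congr 1
    refine Multiset.map_congr rfl fun x _ => ?_
    simp [gE, Polynomial.map_sum, eval_finsetSum]

end Tschirnhaus

/-- **Wiman's theorem.** For `n ≥ 10`, the general equation of degree `n` over a field of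
characteristic zero can be brought, by a Tschirnhaus transformation whose parameters lie in
an extension obtainable by auxiliary equations of degree at most `4`, to the form
`Y^n + C₅ Y^(n-5) + ⋯ + C_n`, i.e. with vanishing coefficients in degrees
`Y^(n-1)`, `Y^(n-2)`, `Y^(n-3)`, `Y^(n-4)`. -/
theorem wiman_degree_ge_ten (F : Type) [Field F] [CharZero F] (n : ℕ) (hn : 10 ≤ n)
    (K : Type) [Field K] [Algebra (MvPolynomial (Fin n) F) K]
    [IsFractionRing (MvPolynomial (Fin n) F) K]
    (c : Fin n → K)
    (hc : ∀ i, c i = algebraMap (MvPolynomial (Fin n) F) K (MvPolynomial.X i))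
    (p : K[X])
    (hp : p = X ^ n + ∑ i : Fin n, Polynomial.C (c i) * X ^ (n - ((i : ℕ) + 1))) :
    ∃ (L : Type) (_ : Field L) (_ : Algebra K L),
      ObtainableByAuxDegLE K L 4 ∧
      ∃ a : Fin n → L, (∃ i : Fin n, (i : ℕ) ≠ 0 ∧ a i ≠ 0) ∧
        letI M := (p.map (algebraMap K L)).SplittingField
        letI q : M[X] :=
          (((p.map (algebraMap K L)).map (algebraMap L M)).roots.map
            (fun x => (Polynomial.X : M[X]) - Polynomial.C (∑ k : Fin n,
              algebraMap L M (a k) * x ^ (k : ℕ)))).prod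
        q.coeff (n - 1) = 0 ∧ q.coeff (n - 2) = 0 ∧ q.coeff (n - 3) = 0 ∧
          q.coeff (n - 4) = 0 := by
  have : CharZero K := charZero_of_injective_algebraMap
    (FaithfulSMul.algebraMap_injective (MvPolynomial (Fin n) F) K)
  have hdeg : p.natDegree = n := by
    have hlt : (∑ i : Fin n, C (c i) * X ^ (n - ((i : ℕ) + 1)) : K[X]).degree < n := by
      refine (degree_sum_le _ _).trans_lt ((Finset.sup_lt_iff (WithBot.bot_lt_coe n)).2 ?_)
      intro i _
      refine (degree_C_mul_X_pow_le _ _).trans_lt ?_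
      exact Nat.cast_lt.2 (by omega)
    rw [hp]
    exact natDegree_eq_of_degree_eq_some
      (by rw [degree_add_eq_left_of_degree_lt (by rwa [degree_X_pow]), degree_X_pow])
  obtain ⟨L, hL, hKL, hobt, a, ha, hsum⟩ := exists_tschirnhaus_sum_pow_eq_zero hn p hdeg
  refine ⟨L, hL, hKL, hobt, a, ha, ?_⟩
  let M := (p.map (algebraMap K L)).SplittingField
  have hsplit := SplittingField.splits (p.map (algebraMap K L))
  have : CharZero L := charZero_of_injective_algebraMap (algebraMap K L).injective
  have : CharZero M := charZero_of_injective_algebraMap (algebraMap L M).injective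
  have hpow := hsum M (algebraMap L M) hsplit
  set Y : Multiset M := ((p.map (algebraMap K L)).map (algebraMap L M)).roots.map
    fun x => ∑ k : Fin n, algebraMap L M (a k) * x ^ (k : ℕ) with hY
  have hcard : Y.card = n := by
    rw [hY, Multiset.card_map, ← hsplit.natDegree_eq_card_roots, natDegree_map, natDegree_map,
      hdeg]
  have hcoeff : ∀ j, 1 ≤ j → j ≤ 4 → (Y.map fun t => X - C t).prod.coeff (n - j) = 0 := by
    intro j h1 h4
    rw [← hcard]
    refine Y.coeff_prod_X_sub_C_eq_zero (by omega) (by omega) fun i hi hij => ?_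
    rw [hY, Multiset.map_map]
    exact hpow i hi (by omega)
  rw [hY, Multiset.map_map] at hcoeff
  exact ⟨hcoeff 1 le_rfl (by omega), hcoeff 2 (by omega) (by omega),
    hcoeff 3 (by omega) (by omega), hcoeff 4 (by omega) le_rfl⟩
end

section
/- Let k be an algebraically closed field and let m ≥ 3. For any two homogeneous polynomials f, g ∈ k[z_1,…,z_m] of degree 2, there exists a common nontrivial zero: some x ∈ k^m with x ≠ 0, f(x) = 0 and g(x) = 0. (In particular, in any projective plane the two quadrics φ_2 = 0 and ψ_2 = 0 have a common point.) -/
open MvPolynomial in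
/-- The ideal of polynomials in `m` variables vanishing at the origin has height at least `m`. -/
theorem le_height_vanishingIdeal_zero (k : Type*) [Field k] (m : ℕ) :
    (m : ℕ∞) ≤ (vanishingIdeal k {(0 : Fin m → k)}).height := by
  let φ (j : ℕ) : MvPolynomial (Fin m) k →ₐ[k] MvPolynomial (Fin m) k :=
    aeval fun i => if (i : ℕ) < j then 0 else X i
  have hφX (j : ℕ) (i : Fin m) : φ j (X i) = if (i : ℕ) < j then 0 else X i := aeval_X _ _
  have hprime (j : ℕ) : (RingHom.ker (φ j)).IsPrime := RingHom.ker_isPrime _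
  have hcomp (j : ℕ) : (φ (j + 1)).comp (φ j) = φ (j + 1) := by
    refine algHom_ext fun i => ?_
    rw [AlgHom.comp_apply, hφX j i]
    split_ifs with h
    · rw [map_zero, hφX, if_pos (h.trans j.lt_succ_self)]
    · rfl
  have hlt (j : ℕ) (hj : j < m) : RingHom.ker (φ j) < RingHom.ker (φ (j + 1)) := by
    refine lt_of_le_of_ne (fun p hp => ?_) fun h => ?_
    · rw [RingHom.mem_ker] at hp ⊢
      rw [← hcomp, AlgHom.comp_apply, hp, map_zero]
    · have hX : (X ⟨j, hj⟩ : MvPolynomial (Fin m) k) ∈ RingHom.ker (φ (j + 1)) := by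
        rw [RingHom.mem_ker, hφX, if_pos j.lt_succ_self]
      rw [← h, RingHom.mem_ker, hφX, if_neg (lt_irrefl j)] at hX
      exact X_ne_zero _ hX
  have hheight (j : ℕ) (hj : j ≤ m) : (j : ℕ∞) ≤ (RingHom.ker (φ j)).height := by
    induction j with
    | zero => simp
    | succ j ih =>
      have h := Ideal.height_add_one_le_of_lt_of_isPrime (hlt j hj)
      push_cast
      exact (add_le_add_left (ih (Nat.le_of_succ_le hj)) 1).trans h
  refine (hheight m le_rfl).trans (Ideal.height_mono fun p hp => ?_)
  have hzero : (aeval (0 : Fin m → k)).comp (φ m) = aeval (0 : Fin m → k) := by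
    refine algHom_ext fun i => ?_
    rw [AlgHom.comp_apply, hφX, if_pos i.isLt, map_zero, aeval_X, Pi.zero_apply]
  rw [RingHom.mem_ker] at hp
  rw [mem_vanishingIdeal_singleton_iff, ← hzero, AlgHom.comp_apply, hp, map_zero]

open MvPolynomial in
/-- Over an algebraically closed field, fewer than `m` polynomials in `m` variables which all
vanish at the origin have another common zero. -/
theorem exists_ne_zero_common_zero (k : Type*) [Field k] [IsAlgClosed k] (m : ℕ)
    (S : Finset (MvPolynomial (Fin m) k)) (hS : S.card < m) (h0 : ∀ p ∈ S, eval 0 p = 0) :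
    ∃ x : Fin m → k, x ≠ 0 ∧ ∀ p ∈ S, eval x p = 0 := by
  by_contra! hne
  have hlocus : zeroLocus k (Ideal.span (S : Set (MvPolynomial (Fin m) k))) = {0} := by
    rw [zeroLocus_span]
    ext x
    simp only [Set.mem_ofPred_eq, Set.mem_singleton_iff, SetLike.mem_coe, aeval_eq_eval]
    refine ⟨fun hx => ?_, fun hx => hx ▸ h0⟩
    by_contra hx0
    obtain ⟨p, hp, hpx⟩ := hne x hx0
    exact hpx (hx p hp)
  have hrad := vanishingIdeal_zeroLocus_eq_radical (K := k)
    (Ideal.span (S : Set (MvPolynomial (Fin m) k)))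
  rw [hlocus] at hrad
  have hmin : vanishingIdeal k {(0 : Fin m → k)} ∈
      (Ideal.span (S : Set (MvPolynomial (Fin m) k))).minimalPrimes := by
    rw [← Ideal.radical_minimalPrimes, ← hrad, Ideal.minimalPrimes_eq_subsingleton_self]
    rfl
  have hle := (le_height_vanishingIdeal_zero k m).trans
    (Ideal.height_le_card_of_mem_minimalPrimes_span_finset hmin)
  exact absurd (Nat.cast_le.mp hle) hS.not_ge

/-- Over an algebraically closed field, any two quadratic forms (homogeneous polynomials
of degree `2`) in `m ≥ 3` variables have a common nontrivial zero. -/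
theorem two_quadrics_common_zero (k : Type*) [Field k] [IsAlgClosed k]
    (m : ℕ) (hm : 3 ≤ m) (f g : MvPolynomial (Fin m) k)
    (hf : f.IsHomogeneous 2) (hg : g.IsHomogeneous 2) :
    ∃ x : Fin m → k, x ≠ 0 ∧ MvPolynomial.eval x f = 0 ∧ MvPolynomial.eval x g = 0 := by
  classical
  have hzero (p : MvPolynomial (Fin m) k) (hp : p.IsHomogeneous 2) :
      MvPolynomial.constantCoeff p = 0 := by
    rw [MvPolynomial.constantCoeff_eq]
    exact hp.coeff_eq_zero (by simp)
  obtain ⟨x, hx, hxS⟩ := exists_ne_zero_common_zero k m {f, g}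
    (Finset.card_le_two.trans_lt hm) (by simp [hzero f hf, hzero g hg])
  exact ⟨x, hx, hxS f (by simp), hxS g (by simp)⟩
end

section
/- Let k be an algebraically closed field of characteristic ≠ 2, and let a_1,…,a_5, b_1,…,b_5 ∈ k satisfy a_i b_j − a_j b_i ≠ 0 for all i ≠ j. Consider the two quadratic forms Q_1(z) = a_1 z_1² + ⋯ + a_5 z_5² and Q_2(z) = b_1 z_1² + ⋯ + b_5 z_5² on k^5. Then the set of 2-dimensional linear subspaces W ⊆ k^5 on which both Q_1 and Q_2 vanish identically has exactly 16 elements. (These 16 common planes of the two quadric cones correspond to the 16 lines on the degree-4 surface obtained as the intersection of the two quadrics in projective 4-space.) -/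
/-- The `2 × 2` minors of the matrix with rows `u` and `v`. -/
def pairMinor {k ι : Type*} [CommRing k] (u v : ι → k) (i j : ι) : k :=
  u i * v j - u j * v i

/-- The product of the minors of `u` and `v` involving the column `i`. -/
def minorProd {k ι : Type*} [CommRing k] [Fintype ι] [DecidableEq ι] (u v : ι → k) (i : ι) : k :=
  ∏ j ∈ Finset.univ.erase i, pairMinor u v i j

/-- The subspace spanned by the rows `a` and `b` after rescaling the coordinates by `s`. -/
def scaledSpan {k ι : Type*} [CommRing k] (a b s : ι → k) : Submodule k (ι → k) :=
  Submodule.span k {s * a, s * b}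

/-- The plane `W` is totally isotropic for the diagonal forms with coefficients `a` and `b`. -/
def IsCommonIsotropicPlane {k ι : Type*} [Field k] [Fintype ι] (a b : ι → k)
    (W : Submodule k (ι → k)) : Prop :=
  Module.finrank k W = 2 ∧ ∀ w ∈ W, (∑ i, a i * w i ^ 2) = 0 ∧ (∑ i, b i * w i ^ 2) = 0

theorem mem_scaledSpan {k ι : Type*} [CommRing k] {a b s w : ι → k} :
    w ∈ scaledSpan a b s ↔ ∃ x y : k, ∀ i, w i = s i * (x * a i + y * b i) := by
  simp only [scaledSpan, Submodule.mem_span_pair, funext_iff, Pi.add_apply, Pi.smul_apply,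
    Pi.mul_apply, smul_eq_mul]
  refine exists_congr fun x => exists_congr fun y => forall_congr' fun i => ?_
  rw [eq_comm, show s i * (x * a i + y * b i) = x * (s i * a i) + y * (s i * b i) by ring]

section Field

variable {k : Type*} [Field k]

theorem finrank_scaledSpan {ι : Type*} {a b s : ι → k} {i j : ι}
    (hab : pairMinor a b i j ≠ 0) (hi : s i ≠ 0) (hj : s j ≠ 0) :
    Module.finrank k (scaledSpan a b s) = 2 := by
  have hind : LinearIndependent k ![s * a, s * b] := by
    rw [LinearIndependent.pair_iff]
    intro x y h
    have h1 := congrFun h i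
    have h3 := congrFun h j
    simp only [Pi.add_apply, Pi.smul_apply, Pi.mul_apply, smul_eq_mul, Pi.zero_apply] at h1 h3
    have e1 : x * a i + y * b i = 0 := by
      apply (mul_eq_zero.1 (?_ : s i * (x * a i + y * b i) = 0)).resolve_left hi
      linear_combination h1
    have e2 : x * a j + y * b j = 0 := by
      apply (mul_eq_zero.1 (?_ : s j * (x * a j + y * b j) = 0)).resolve_left hj
      linear_combination h3
    unfold pairMinor at hab
    constructor
    · apply (mul_eq_zero.1 (?_ : _ * x = 0)).resolve_left hab
      linear_combination b j * e1 - b i * e2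
    · apply (mul_eq_zero.1 (?_ : _ * y = 0)).resolve_left hab
      linear_combination a i * e2 - a j * e1
  have := finrank_span_eq_card hind
  rw [Matrix.range_cons, Matrix.range_cons, Matrix.range_empty, Set.union_empty,
    Set.singleton_union] at this
  exact this.trans (Fintype.card_fin 2)

/-- Polarization of a diagonal quadratic form vanishing on a subspace. -/
theorem sum_mul_mul_eq_zero_of_isotropic {ι : Type*} [Fintype ι] (h2 : (2 : k) ≠ 0) {a : ι → k}
    {W : Submodule k (ι → k)} (h : ∀ w ∈ W, ∑ i, a i * w i ^ 2 = 0)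
    {u v : ι → k} (hu : u ∈ W) (hv : v ∈ W) : ∑ i, a i * (u i * v i) = 0 := by
  have huv := h _ (W.add_mem hu hv)
  have : ∑ i, a i * (u + v) i ^ 2 =
      ∑ i, a i * u i ^ 2 + ∑ i, a i * v i ^ 2 + 2 * ∑ i, a i * (u i * v i) := by
    rw [Finset.mul_sum, ← Finset.sum_add_distrib, ← Finset.sum_add_distrib]
    exact Finset.sum_congr rfl fun i _ => by simp only [Pi.add_apply]; ring
  rw [huv, h u hu, h v hv] at this
  simpa [h2] using this.symm

theorem exists_univ_fin_five_eq (i j : Fin 5) (hij : i ≠ j) :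
    ∃ l m n : Fin 5, (l ≠ m ∧ l ≠ n ∧ m ≠ n) ∧ [i, j, l, m, n].Nodup ∧
      Finset.univ = [i, j, l, m, n].toFinset := by
  revert i j
  decide

theorem exists_sum_fin_five_eq (i j : Fin 5) (hij : i ≠ j) :
    ∃ l m n : Fin 5, (l ≠ m ∧ l ≠ n ∧ m ≠ n) ∧
      ∀ f : Fin 5 → k, ∑ x, f x = f i + f j + f l + f m + f n := by
  obtain ⟨l, m, n, h, hnd, hu⟩ := exists_univ_fin_five_eq i j hij
  refine ⟨l, m, n, h, fun f => ?_⟩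
  rw [hu, List.sum_toFinset f hnd]
  simp [add_assoc]

/-- A solution of two independent equations in two unknowns vanishes. -/
theorem eq_zero_of_pairMinor_ne_zero {ι : Type*} {a b : ι → k} {i j : ι}
    (h : pairMinor a b i j ≠ 0) {x y : k} (ha : a i * x + a j * y = 0)
    (hb : b i * x + b j * y = 0) : x = 0 ∧ y = 0 := by
  unfold pairMinor at h
  constructor
  · apply (mul_eq_zero.1 (?_ : _ * x = 0)).resolve_left h
    linear_combination b j * ha - a j * hb
  · apply (mul_eq_zero.1 (?_ : _ * y = 0)).resolve_left h
    linear_combination a i * hb - b i * ha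

/-- Two solutions of a pair of independent equations in three unknowns are proportional. -/
theorem mul_eq_mul_of_pairMinor_ne_zero {ι : Type*} {a b : ι → k} {l m n : ι}
    (h : pairMinor a b l n ≠ 0) {x y z x' y' z' : k}
    (ha : a l * x + a m * y + a n * z = 0) (hb : b l * x + b m * y + b n * z = 0)
    (ha' : a l * x' + a m * y' + a n * z' = 0) (hb' : b l * x' + b m * y' + b n * z' = 0) :
    x * y' = y * x' := by
  unfold pairMinor at h
  rw [← sub_eq_zero]
  apply (mul_eq_zero.1 (?_ : _ * (x * y' - y * x') = 0)).resolve_left h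
  linear_combination y' * (b n * ha - a n * hb) - y * (b n * ha' - a n * hb')

section Isotropic

variable {a b : Fin 5 → k} {W : Submodule k (Fin 5 → k)}

theorem IsCommonIsotropicPlane.eq_zero_of_apply_eq_zero (hW : IsCommonIsotropicPlane a b W)
    (h2 : (2 : k) ≠ 0) (hab : ∀ i j, i ≠ j → pairMinor a b i j ≠ 0) {w : Fin 5 → k} (hw : w ∈ W)
    {i j : Fin 5} (hij : i ≠ j) (hi : w i = 0) (hj : w j = 0) : w = 0 := by
  obtain ⟨l, m, n, ⟨hlm, hln, hmn⟩, hsum⟩ := exists_sum_fin_five_eq (k := k) i j hij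
  have hext : ∀ v : Fin 5 → k, v i = 0 → v j = 0 → v l = 0 → v m = 0 → v n = 0 → v = 0 := by
    intro v h1 h3 h4 h5 h6
    classical
    funext x
    have := hsum fun y => if y = x then v x else 0
    rw [Finset.sum_ite_eq' Finset.univ x] at this
    simp only [Finset.mem_univ, if_true] at this
    rw [this]
    have (y : Fin 5) (hy : v y = 0) : (if y = x then v x else 0) = 0 := by
      split_ifs with e
      · rw [← e, hy]
      · rfl
    simp [this, h1, h3, h4, h5, h6]
  have pol (v : Fin 5 → k) (hv : v ∈ W) :
      a l * (w l * v l) + a m * (w m * v m) + a n * (w n * v n) = 0 ∧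
      b l * (w l * v l) + b m * (w m * v m) + b n * (w n * v n) = 0 := by
    have e1 := sum_mul_mul_eq_zero_of_isotropic h2 (fun w hw => (hW.2 w hw).1) hw hv
    have e2 := sum_mul_mul_eq_zero_of_isotropic h2 (fun w hw => (hW.2 w hw).2) hw hv
    rw [hsum, hi, hj] at e1 e2
    constructor
    · linear_combination e1
    · linear_combination e2
  obtain ⟨qa, qb⟩ := pol w hw
  by_contra hne
  have hl : w l ≠ 0 := by
    intro h
    obtain ⟨h3, h4⟩ := eq_zero_of_pairMinor_ne_zero (hab m n hmn)
      (x := w m * w m) (y := w n * w n) (by simpa [h] using qa) (by simpa [h] using qb)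
    exact hne (hext w hi hj h (mul_self_eq_zero.1 h3) (mul_self_eq_zero.1 h4))
  have hm : w m ≠ 0 := by
    intro h
    obtain ⟨h3, h4⟩ := eq_zero_of_pairMinor_ne_zero (hab l n hln)
      (x := w l * w l) (y := w n * w n) (by simpa [h] using qa) (by simpa [h] using qb)
    exact hl (mul_self_eq_zero.1 h3)
  have hn : w n ≠ 0 := by
    intro h
    obtain ⟨h3, h4⟩ := eq_zero_of_pairMinor_ne_zero (hab l m hlm)
      (x := w l * w l) (y := w m * w m) (by simpa [h] using qa) (by simpa [h] using qb)
    exact hl (mul_self_eq_zero.1 h3)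
  have hspan : W ≤ Submodule.span k {w} := by
    intro v hv
    obtain ⟨pa, pb⟩ := pol v hv
    have em : w l * v m = w m * v l := by
      have := mul_eq_mul_of_pairMinor_ne_zero (hab l n hln) qa qb pa pb
      apply mul_left_cancel₀ (mul_ne_zero hl hm)
      linear_combination this
    have en : w l * v n = w n * v l := by
      have := mul_eq_mul_of_pairMinor_ne_zero (x := w l * w l) (y := w n * w n) (z := w m * w m)
        (x' := w l * v l) (y' := w n * v n) (z' := w m * v m) (m := n) (hab l m hlm)
        (by linear_combination qa) (by linear_combination qb)
        (by linear_combination pa) (by linear_combination pb)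
      apply mul_left_cancel₀ (mul_ne_zero hl hn)
      linear_combination this
    have hmem : w l • v - v l • w ∈ W := W.sub_mem (W.smul_mem _ hv) (W.smul_mem _ hw)
    obtain ⟨ra, rb⟩ := hW.2 _ hmem
    rw [hsum] at ra rb
    simp only [Pi.sub_apply, Pi.smul_apply, smul_eq_mul, hi, hj] at ra rb
    have e0 : w l * v m - v l * w m = 0 := by linear_combination em
    have e1 : w l * v n - v l * w n = 0 := by linear_combination en
    rw [e0, e1] at ra rb
    obtain ⟨h3, h4⟩ := eq_zero_of_pairMinor_ne_zero (hab i j hij)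
      (x := (w l * v i) ^ 2) (y := (w l * v j) ^ 2)
      (by linear_combination ra) (by linear_combination rb)
    have hz : w l • v - v l • w = 0 := by
      apply hext <;> simp only [Pi.sub_apply, Pi.smul_apply, smul_eq_mul]
      · simpa [hi] using h3
      · simpa [hj] using h4
      · ring
      · exact e0
      · exact e1
    rw [Submodule.mem_span_singleton]
    refine ⟨(w l)⁻¹ * v l, ?_⟩
    rw [mul_smul, ← sub_eq_zero.1 hz, smul_smul, inv_mul_cancel₀ hl, one_smul]
  have := Submodule.finrank_mono hspan
  rw [hW.1, finrank_span_singleton hne] at this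
  omega

theorem IsCommonIsotropicPlane.exists_span_pair (hW : IsCommonIsotropicPlane a b W)
    (h2 : (2 : k) ≠ 0) (hab : ∀ i j, i ≠ j → pairMinor a b i j ≠ 0) :
    ∃ u ∈ W, ∃ v ∈ W, ∀ i j, i ≠ j → pairMinor u v i j ≠ 0 := by
  let B := Module.finBasisOfFinrankEq k W hW.1
  have hind : LinearIndependent k ![(B 0 : Fin 5 → k), (B 1 : Fin 5 → k)] := by
    have := B.linearIndependent.map' W.subtype W.ker_subtype
    have hB : W.subtype ∘ B = ![(B 0 : Fin 5 → k), (B 1 : Fin 5 → k)] := by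
      funext i
      fin_cases i <;> rfl
    rwa [hB] at this
  rw [LinearIndependent.pair_iff] at hind
  refine ⟨B 0, (B 0).2, B 1, (B 1).2, fun i j hij h => ?_⟩
  have key (x : Fin 5) (hx : x = i ∨ x = j) :
      (B 1 : Fin 5 → k) x = 0 ∧ (B 0 : Fin 5 → k) x = 0 := by
    have hz : (B 1 : Fin 5 → k) x • (B 0 : Fin 5 → k) + (-(B 0 : Fin 5 → k) x) • (B 1 : Fin 5 → k)
        = 0 := by
      apply hW.eq_zero_of_apply_eq_zero h2 hab
        (W.add_mem (W.smul_mem _ (B 0).2) (W.smul_mem _ (B 1).2)) hij <;>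
      simp only [Pi.add_apply, Pi.smul_apply, smul_eq_mul] <;>
      unfold pairMinor at h <;> rcases hx with rfl | rfl <;>
      first | linear_combination (0 : k) * h | linear_combination h | linear_combination -h
    simpa using hind _ _ hz
  have hz := hW.eq_zero_of_apply_eq_zero h2 hab (B 0).2 hij (key i (.inl rfl)).2
    (key j (.inr rfl)).2
  have := hind 1 0 (by simp [hz])
  simp at this

end Isotropic

theorem minorProd_ne_zero {ι : Type*} [Fintype ι] [DecidableEq ι] {u v : ι → k}
    (h : ∀ i j, i ≠ j → pairMinor u v i j ≠ 0) (i : ι) : minorProd u v i ≠ 0 :=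
  Finset.prod_ne_zero_iff.2 fun j hj => h i j (Finset.ne_of_mem_erase hj).symm

theorem minorProd_fin_five {R : Type*} [CommRing R] (u v : Fin 5 → R) :
    minorProd u v =
      ![pairMinor u v 0 1 * pairMinor u v 0 2 * pairMinor u v 0 3 * pairMinor u v 0 4,
        -(pairMinor u v 0 1 * pairMinor u v 1 2 * pairMinor u v 1 3 * pairMinor u v 1 4),
        pairMinor u v 0 2 * pairMinor u v 1 2 * pairMinor u v 2 3 * pairMinor u v 2 4,
        -(pairMinor u v 0 3 * pairMinor u v 1 3 * pairMinor u v 2 3 * pairMinor u v 3 4),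
        pairMinor u v 0 4 * pairMinor u v 1 4 * pairMinor u v 2 4 * pairMinor u v 3 4] := by
  have e (i : Fin 5) : (Finset.univ.erase i : Finset (Fin 5)) =
    ![{1, 2, 3, 4}, {0, 2, 3, 4}, {0, 1, 3, 4}, {0, 1, 2, 4}, {0, 1, 2, 3}] i := by
    revert i
    decide
  have anti (i j : Fin 5) : pairMinor u v i j = -pairMinor u v j i := by
    unfold pairMinor
    ring
  funext i
  unfold minorProd
  rw [e]
  fin_cases i <;> simp [Finset.prod_insert]
  · ring
  · rw [anti 1 0]; ring
  · rw [anti 2 0, anti 2 1]; ring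
  · rw [anti 3 0, anti 3 1, anti 3 2]; ring
  · rw [anti 4 0, anti 4 1, anti 4 2, anti 4 3]; ring

/-- Gale duality for five points on the projective line. -/
theorem minorProd_mul_mem {u v a : Fin 5 → k} {W : Submodule k (Fin 5 → k)} (hu : u ∈ W)
    (hv : v ∈ W) (h01 : pairMinor u v 0 1 ≠ 0) (huu : ∑ i, a i * u i ^ 2 = 0)
    (huv : ∑ i, a i * (u i * v i) = 0) (hvv : ∑ i, a i * v i ^ 2 = 0) :
    minorProd u v * a ∈ W := by
  have hq (x y : Fin 5) : ∑ i, a i * (pairMinor u v i x * pairMinor u v i y) = 0 := by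
    have : ∑ i, a i * (pairMinor u v i x * pairMinor u v i y) =
        v x * v y * ∑ i, a i * u i ^ 2 - (u x * v y + v x * u y) * ∑ i, a i * (u i * v i) +
          u x * u y * ∑ i, a i * v i ^ 2 := by
      simp only [Finset.mul_sum, ← Finset.sum_sub_distrib, ← Finset.sum_add_distrib]
      exact Finset.sum_congr rfl fun i _ => by unfold pairMinor; ring
    rw [this, huu, huv, hvv]
    ring
  have anti (i j : Fin 5) : pairMinor u v i j = -pairMinor u v j i := by
    unfold pairMinor
    ring
  have self (i : Fin 5) : pairMinor u v i i = 0 := by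
    unfold pairMinor
    ring
  set D := minorProd u v with hD
  have hl (i : Fin 5) : pairMinor u v 0 1 * (D i * a i) =
      D 1 * a 1 * pairMinor u v 0 i - D 0 * a 0 * pairMinor u v 1 i := by
    have h23 := hq 2 3
    have h24 := hq 2 4
    have h34 := hq 3 4
    rw [hD, minorProd_fin_five]
    simp only [Fin.sum_univ_five, self, anti 4 3, anti 4 2, anti 3 2] at h23 h24 h34
    fin_cases i <;> simp [self, anti 1 0]
    · ring
    · ring
    · linear_combination pairMinor u v 0 1 * pairMinor u v 0 2 * pairMinor u v 1 2 * h34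
    · linear_combination pairMinor u v 0 1 * pairMinor u v 0 3 * pairMinor u v 1 3 * h24
    · linear_combination pairMinor u v 0 1 * pairMinor u v 0 4 * pairMinor u v 1 4 * h23
  have : D * a = (pairMinor u v 0 1)⁻¹ •
      ((D 1 * a 1 * u 0 - D 0 * a 0 * u 1) • v - (D 1 * a 1 * v 0 - D 0 * a 0 * v 1) • u) := by
    funext i
    simp only [Pi.mul_apply, Pi.smul_apply, Pi.sub_apply, smul_eq_mul]
    rw [eq_inv_mul_iff_mul_eq₀ h01, hl]
    unfold pairMinor
    ring
  rw [this]
  exact W.smul_mem _ (W.sub_mem (W.smul_mem _ hv) (W.smul_mem _ hu))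

/-- The cubic moments of `e` on the points `(aᵢ : bᵢ)` vanish when `eᵢ` is the inverse of the
product of minors at `i`. -/
theorem sum_mul_pow_mul_pow_eq_zero {a b e : Fin 5 → k}
    (hab : ∀ i j, i ≠ j → pairMinor a b i j ≠ 0) (he : ∀ i, e i * minorProd a b i = 1) {m n : ℕ}
    (hmn : m + n = 3) : ∑ i, e i * (a i ^ m * b i ^ n) = 0 := by
  have hV : pairMinor a b 0 1 * pairMinor a b 0 2 * pairMinor a b 0 3 * pairMinor a b 0 4 *
      pairMinor a b 1 2 * pairMinor a b 1 3 * pairMinor a b 1 4 * pairMinor a b 2 3 *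
      pairMinor a b 2 4 * pairMinor a b 3 4 ≠ 0 := by
    refine mul_ne_zero (mul_ne_zero (mul_ne_zero (mul_ne_zero (mul_ne_zero (mul_ne_zero
      (mul_ne_zero (mul_ne_zero (mul_ne_zero ?_ ?_) ?_) ?_) ?_) ?_) ?_) ?_) ?_) ?_ <;>
    exact hab _ _ (by decide)
  have h0 := he 0
  have h1 := he 1
  have h2 := he 2
  have h3 := he 3
  have h4 := he 4
  simp only [minorProd_fin_five, Matrix.cons_val] at h0 h1 h2 h3 h4
  have key : a 0 ^ m * b 0 ^ n * (pairMinor a b 1 2 * pairMinor a b 1 3 * pairMinor a b 1 4 *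
        pairMinor a b 2 3 * pairMinor a b 2 4 * pairMinor a b 3 4) -
      a 1 ^ m * b 1 ^ n * (pairMinor a b 0 2 * pairMinor a b 0 3 * pairMinor a b 0 4 *
        pairMinor a b 2 3 * pairMinor a b 2 4 * pairMinor a b 3 4) +
      a 2 ^ m * b 2 ^ n * (pairMinor a b 0 1 * pairMinor a b 0 3 * pairMinor a b 0 4 *
        pairMinor a b 1 3 * pairMinor a b 1 4 * pairMinor a b 3 4) -
      a 3 ^ m * b 3 ^ n * (pairMinor a b 0 1 * pairMinor a b 0 2 * pairMinor a b 0 4 *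
        pairMinor a b 1 2 * pairMinor a b 1 4 * pairMinor a b 2 4) +
      a 4 ^ m * b 4 ^ n * (pairMinor a b 0 1 * pairMinor a b 0 2 * pairMinor a b 0 3 *
        pairMinor a b 1 2 * pairMinor a b 1 3 * pairMinor a b 2 3) = 0 := by
    have hm : m ≤ 3 := by omega
    obtain rfl : n = 3 - m := by omega
    unfold pairMinor
    interval_cases m <;> ring
  apply mul_left_cancel₀ hV
  rw [mul_zero, Fin.sum_univ_five]
  linear_combination key +
    a 0 ^ m * b 0 ^ n * (pairMinor a b 1 2 * pairMinor a b 1 3 * pairMinor a b 1 4 *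
        pairMinor a b 2 3 * pairMinor a b 2 4 * pairMinor a b 3 4) * h0 -
      a 1 ^ m * b 1 ^ n * (pairMinor a b 0 2 * pairMinor a b 0 3 * pairMinor a b 0 4 *
        pairMinor a b 2 3 * pairMinor a b 2 4 * pairMinor a b 3 4) * h1 +
      a 2 ^ m * b 2 ^ n * (pairMinor a b 0 1 * pairMinor a b 0 3 * pairMinor a b 0 4 *
        pairMinor a b 1 3 * pairMinor a b 1 4 * pairMinor a b 3 4) * h2 -
      a 3 ^ m * b 3 ^ n * (pairMinor a b 0 1 * pairMinor a b 0 2 * pairMinor a b 0 4 *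
        pairMinor a b 1 2 * pairMinor a b 1 4 * pairMinor a b 2 4) * h3 +
      a 4 ^ m * b 4 ^ n * (pairMinor a b 0 1 * pairMinor a b 0 2 * pairMinor a b 0 3 *
        pairMinor a b 1 2 * pairMinor a b 1 3 * pairMinor a b 2 3) * h4

/-- Vanishing of the cubic moments determines the weights up to a common factor. -/
theorem mul_minorProd_eq {a b e : Fin 5 → k}
    (h30 : ∑ i, e i * a i ^ 3 = 0) (h21 : ∑ i, e i * (a i ^ 2 * b i) = 0)
    (h12 : ∑ i, e i * (a i * b i ^ 2) = 0) (h03 : ∑ i, e i * b i ^ 3 = 0) (i : Fin 5) :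
    e i * minorProd a b i = e 0 * minorProd a b 0 := by
  have hc (x y z : Fin 5) :
      ∑ i, e i * (pairMinor a b i x * pairMinor a b i y * pairMinor a b i z) = 0 := by
    have : ∑ i, e i * (pairMinor a b i x * pairMinor a b i y * pairMinor a b i z) =
        b x * b y * b z * ∑ i, e i * a i ^ 3 -
        (a x * b y * b z + b x * a y * b z + b x * b y * a z) * ∑ i, e i * (a i ^ 2 * b i) +
        (b x * a y * a z + a x * b y * a z + a x * a y * b z) * ∑ i, e i * (a i * b i ^ 2) -
        a x * a y * a z * ∑ i, e i * b i ^ 3 := by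
      simp only [Finset.mul_sum, ← Finset.sum_sub_distrib, ← Finset.sum_add_distrib]
      exact Finset.sum_congr rfl fun i _ => by unfold pairMinor; ring
    rw [this, h30, h21, h12, h03]
    ring
  have anti (i j : Fin 5) : pairMinor a b i j = -pairMinor a b j i := by
    unfold pairMinor
    ring
  have self (i : Fin 5) : pairMinor a b i i = 0 := by
    unfold pairMinor
    ring
  have h1 := hc 2 3 4
  have h2 := hc 1 3 4
  have h3 := hc 1 2 4
  have h4 := hc 1 2 3
  simp only [Fin.sum_univ_five, self, anti 2 1, anti 3 1, anti 4 1, anti 4 3, anti 4 2, anti 3 2]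
    at h1 h2 h3 h4
  rw [minorProd_fin_five]
  fin_cases i <;> simp
  · linear_combination -pairMinor a b 0 1 * h1
  · linear_combination -pairMinor a b 0 2 * h2
  · linear_combination -pairMinor a b 0 3 * h3
  · linear_combination -pairMinor a b 0 4 * h4

theorem isCommonIsotropicPlane_scaledSpan {a b s : Fin 5 → k}
    (hab : ∀ i j, i ≠ j → pairMinor a b i j ≠ 0) (hs : ∀ i, s i ^ 2 * minorProd a b i = 1) :
    IsCommonIsotropicPlane a b (scaledSpan a b s) := by
  have hs0 (i : Fin 5) : s i ≠ 0 := fun h => by simpa [h] using hs i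
  refine ⟨finrank_scaledSpan (hab 0 1 (by decide)) (hs0 0) (hs0 1), fun w hw => ?_⟩
  obtain ⟨x, y, hw⟩ := mem_scaledSpan.1 hw
  have h30 := sum_mul_pow_mul_pow_eq_zero hab hs (m := 3) (n := 0) rfl
  have h21 := sum_mul_pow_mul_pow_eq_zero hab hs (m := 2) (n := 1) rfl
  have h12 := sum_mul_pow_mul_pow_eq_zero hab hs (m := 1) (n := 2) rfl
  have h03 := sum_mul_pow_mul_pow_eq_zero hab hs (m := 0) (n := 3) rfl
  simp only [hw, Fin.sum_univ_five] at h30 h21 h12 h03 ⊢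
  constructor
  · linear_combination x ^ 2 * h30 + 2 * x * y * h21 + y ^ 2 * h12
  · linear_combination x ^ 2 * h21 + 2 * x * y * h12 + y ^ 2 * h03

/-- The vector `r` with the signs of all coordinates but the first changed by `ε`. -/
def signTwist (r : Fin 5 → k) (ε : Fin 4 → ℤˣ) (i : Fin 5) : k :=
  (((Fin.cons 1 ε : Fin 5 → ℤˣ) i : ℤ) : k) * r i

theorem signTwist_sq (r : Fin 5 → k) (ε : Fin 4 → ℤˣ) (i : Fin 5) :
    signTwist r ε i ^ 2 = r i ^ 2 := by
  unfold signTwist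
  rcases Int.units_eq_one_or ((Fin.cons 1 ε : Fin 5 → ℤˣ) i) with h | h <;> simp [h]

theorem exists_eq_mul_signTwist {r s : Fin 5 → k} (hr : r 0 ≠ 0)
    (h : ∀ i, s i ^ 2 * r 0 ^ 2 = s 0 ^ 2 * r i ^ 2) :
    ∃ ε, ∀ i, s i = s 0 / r 0 * signTwist r ε i := by
  have (i : Fin 4) : ∃ η : ℤˣ, s i.succ = s 0 / r 0 * (((η : ℤ) : k) * r i.succ) := by
    have : s i.succ ^ 2 = (s 0 / r 0 * r i.succ) ^ 2 := by
      rw [mul_pow, div_pow, div_mul_eq_mul_div, eq_div_iff (pow_ne_zero 2 hr), h]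
    rcases sq_eq_sq_iff_eq_or_eq_neg.1 this with h | h
    · exact ⟨1, by simp [h]⟩
    · exact ⟨-1, by simp [h]⟩
  choose ε hε using this
  refine ⟨ε, fun i => ?_⟩
  refine Fin.cases ?_ (fun i => ?_) i
  · simp [signTwist, hr]
  · simpa [signTwist] using hε i

theorem IsCommonIsotropicPlane.exists_eq_scaledSpan {a b r : Fin 5 → k}
    {W : Submodule k (Fin 5 → k)} (hW : IsCommonIsotropicPlane a b W) (h2 : (2 : k) ≠ 0)
    (hab : ∀ i j, i ≠ j → pairMinor a b i j ≠ 0) (hr : ∀ i, r i ^ 2 * minorProd a b i = 1) :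
    ∃ ε, W = scaledSpan a b (signTwist r ε) := by
  have hr0 (i : Fin 5) : r i ≠ 0 := fun h => by simpa [h] using hr i
  obtain ⟨u, hu, v, hv, huv⟩ := hW.exists_span_pair h2 hab
  have hQa : ∀ w ∈ W, ∑ i, a i * w i ^ 2 = 0 := fun w hw => (hW.2 w hw).1
  have hQb : ∀ w ∈ W, ∑ i, b i * w i ^ 2 = 0 := fun w hw => (hW.2 w hw).2
  have hDa : minorProd u v * a ∈ W := minorProd_mul_mem hu hv (huv 0 1 (by decide)) (hQa u hu)
    (sum_mul_mul_eq_zero_of_isotropic h2 hQa hu hv) (hQa v hv)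
  have hDb : minorProd u v * b ∈ W := minorProd_mul_mem hu hv (huv 0 1 (by decide)) (hQb u hu)
    (sum_mul_mul_eq_zero_of_isotropic h2 hQb hu hv) (hQb v hv)
  have hD := minorProd_ne_zero huv
  generalize minorProd u v = D at hDa hDb hD
  have hDW : scaledSpan a b D = W := by
    have : Module.finrank k (scaledSpan a b D) = 2 :=
      finrank_scaledSpan (hab 0 1 (by decide)) (hD 0) (hD 1)
    refine Submodule.eq_of_le_of_finrank_eq ?_ (this.trans hW.1.symm)
    rw [scaledSpan, Submodule.span_le, Set.insert_subset_iff, Set.singleton_subset_iff]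
    exact ⟨hDa, hDb⟩
  have hmom (c d : Fin 5 → k) (h : ∑ i, c i * (D * d) i ^ 2 = 0) (f : Fin 5 → k)
      (hf : ∀ i, f i = c i * d i ^ 2) : ∑ i, D i ^ 2 * f i = 0 := by
    rw [← h]
    exact Finset.sum_congr rfl fun i _ => by rw [hf, Pi.mul_apply]; ring
  have hconst (i : Fin 5) := mul_minorProd_eq (e := fun i => D i ^ 2) (a := a) (b := b)
    (hmom a a (hQa _ hDa) _ fun i => by ring) (hmom b a (hQb _ hDa) _ fun i => by ring)
    (hmom a b (hQa _ hDb) _ fun i => by ring) (hmom b b (hQb _ hDb) _ fun i => by ring) i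
  obtain ⟨ε, hε⟩ := exists_eq_mul_signTwist (s := D) (hr0 0) fun i => by
    linear_combination r 0 ^ 2 * r i ^ 2 * hconst i - D i ^ 2 * r 0 ^ 2 * hr i
      + D 0 ^ 2 * r i ^ 2 * hr 0
  refine ⟨ε, ?_⟩
  have hs0 (i : Fin 5) : signTwist r ε i ≠ 0 := fun h => hD i (by rw [hε, h, mul_zero])
  rw [← hDW]
  refine Submodule.eq_of_le_of_finrank_eq (fun w hw => ?_) ?_
  · obtain ⟨x, y, hw⟩ := mem_scaledSpan.1 hw
    refine mem_scaledSpan.2 ⟨D 0 / r 0 * x, D 0 / r 0 * y, fun i => ?_⟩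
    rw [hw, hε]
    ring
  · rw [finrank_scaledSpan (hab 0 1 (by decide)) (hD 0) (hD 1),
      finrank_scaledSpan (hab 0 1 (by decide)) (hs0 0) (hs0 1)]

theorem scaledSpan_signTwist_injective {a b r : Fin 5 → k} (h2 : (2 : k) ≠ 0)
    (hab : ∀ i j, i ≠ j → pairMinor a b i j ≠ 0) (hr : ∀ i, r i ≠ 0) :
    Function.Injective fun ε : Fin 4 → ℤˣ => scaledSpan a b (signTwist r ε) := by
  intro ε η h
  simp only at h
  have hsub : ({signTwist r η * a, signTwist r η * b} : Set (Fin 5 → k)) ⊆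
      scaledSpan a b (signTwist r ε) := by
    rw [h]
    exact Submodule.subset_span
  rw [Set.insert_subset_iff, Set.singleton_subset_iff] at hsub
  obtain ⟨x, y, hxy⟩ := mem_scaledSpan.1 hsub.1
  obtain ⟨z, t, hzt⟩ := mem_scaledSpan.1 hsub.2
  let σ (i : Fin 5) : ℤˣ := (Fin.cons 1 η : Fin 5 → ℤˣ) i * (Fin.cons 1 ε : Fin 5 → ℤˣ) i
  have hσ (i : Fin 5) : signTwist r η i = signTwist r ε i * ((σ i : ℤ) : k) := by
    simp only [signTwist, σ]
    rcases Int.units_eq_one_or ((Fin.cons 1 ε : Fin 5 → ℤˣ) i) with h | h <;>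
      simp [h, mul_comm]
  have hε0 (i : Fin 5) : signTwist r ε i ≠ 0 := by
    intro h
    have := signTwist_sq r ε i
    rw [h, zero_pow two_ne_zero] at this
    exact hr i (pow_eq_zero_iff two_ne_zero |>.1 this.symm)
  have ha (i : Fin 5) : ((σ i : ℤ) : k) * a i = x * a i + y * b i := by
    apply mul_left_cancel₀ (hε0 i)
    rw [← hxy i, Pi.mul_apply, hσ]
    ring
  have hb (i : Fin 5) : ((σ i : ℤ) : k) * b i = z * a i + t * b i := by
    apply mul_left_cancel₀ (hε0 i)
    rw [← hzt i, Pi.mul_apply, hσ]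
    ring
  have htr (i j : Fin 5) (hij : i ≠ j) : ((σ i : ℤ) : k) + ((σ j : ℤ) : k) = x + t := by
    apply mul_right_cancel₀ (hab i j hij)
    unfold pairMinor
    linear_combination b j * ha i - a j * hb i + a i * hb j - b i * ha j
  have hσ0 : σ 0 = 1 := by simp [σ]
  have hone (i : Fin 5) : ((σ i : ℤ) : k) = 1 := by
    have h0 : ((σ 0 : ℤ) : k) = 1 := by simp [hσ0]
    by_cases hi : i = 0
    · rw [hi, h0]
    · obtain ⟨j, hj0, hji⟩ : ∃ j : Fin 5, j ≠ 0 ∧ j ≠ i := by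
        revert i
        decide
      linear_combination htr i j hji.symm - htr 0 j hj0.symm + h0
  have hu (i : Fin 5) : σ i = 1 := by
    rcases Int.units_eq_one_or (σ i) with h | h
    · exact h
    · have := hone i
      rw [h] at this
      simp only [Units.val_neg, Units.val_one, Int.cast_neg, Int.cast_one] at this
      exact absurd (by linear_combination -this) h2
  funext i
  have := hu i.succ
  simp only [σ, Fin.cons_succ] at this
  rw [mul_eq_one_iff_eq_inv, Int.units_inv_eq_self] at this
  exact this.symm

end Field


/-- Over an algebraically closed field of characteristic `≠ 2`, two diagonal quadratic
forms `Q₁ z = Σ aᵢ zᵢ²`, `Q₂ z = Σ bᵢ zᵢ²` on `k^5` whose coefficient pairs are pairwise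
non-proportional (`aᵢ bⱼ − aⱼ bᵢ ≠ 0` for `i ≠ j`) have exactly `16` common totally
isotropic planes: these are the `16` lines on the degree-4 del Pezzo surface obtained as
the intersection of the two quadrics in `ℙ⁴`. -/
theorem sixteen_common_isotropic_planes (k : Type*) [Field k] [IsAlgClosed k]
    (h2 : (2 : k) ≠ 0) (a b : Fin 5 → k)
    (hab : ∀ i j : Fin 5, i ≠ j → a i * b j - a j * b i ≠ 0) :
    ({W : Submodule k (Fin 5 → k) | Module.finrank k W = 2 ∧
        ∀ w ∈ W, (∑ i : Fin 5, a i * w i ^ 2) = 0 ∧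
          (∑ i : Fin 5, b i * w i ^ 2) = 0} : Set (Submodule k (Fin 5 → k))).Finite ∧
    ({W : Submodule k (Fin 5 → k) | Module.finrank k W = 2 ∧
        ∀ w ∈ W, (∑ i : Fin 5, a i * w i ^ 2) = 0 ∧
          (∑ i : Fin 5, b i * w i ^ 2) = 0} : Set (Submodule k (Fin 5 → k))).ncard
      = 16 := by
  have hm : ∀ i j, i ≠ j → pairMinor a b i j ≠ 0 := hab
  have hr (i : Fin 5) : ∃ r : k, r ^ 2 * minorProd a b i = 1 := by
    obtain ⟨r, hr⟩ := IsAlgClosed.exists_pow_nat_eq (minorProd a b i)⁻¹ two_pos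
    exact ⟨r, by rw [hr, inv_mul_cancel₀ (minorProd_ne_zero hm i)]⟩
  choose r hr using hr
  have hset : {W : Submodule k (Fin 5 → k) | Module.finrank k W = 2 ∧
      ∀ w ∈ W, (∑ i : Fin 5, a i * w i ^ 2) = 0 ∧ (∑ i : Fin 5, b i * w i ^ 2) = 0} =
      Set.range fun ε : Fin 4 → ℤˣ => scaledSpan a b (signTwist r ε) := by
    ext W
    constructor
    · intro hW
      obtain ⟨ε, h⟩ := IsCommonIsotropicPlane.exists_eq_scaledSpan hW h2 hm hr
      exact ⟨ε, h.symm⟩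
    · rintro ⟨ε, rfl⟩
      exact isCommonIsotropicPlane_scaledSpan hm fun i => by rw [signTwist_sq, hr]
  rw [hset]
  refine ⟨Set.finite_range _, ?_⟩
  rw [← Set.image_univ, Set.ncard_image_of_injective _ (scaledSpan_signTwist_injective h2 hm
    fun i h => by simpa [h] using hr i), Set.ncard_univ]
  simp
end
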